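/- For every policy π and every φ with Z = φ(S,G), the conditional KL risk is bounded below by the representation error: R(π;φ) ≥ I(A;G|S,Z). -/

import Mathlib

open scoped Classical
open Finset

/-- Joint probability `P(f = x)` of a discrete random variable `f` on the sample space
`𝒮 × 𝒢 × 𝒜` equipped with the pmf `p`. -/
noncomputable def Pr {𝒮 𝒢 𝒜 : Type*} [Fintype 𝒮] [Fintype 𝒢] [Fintype 𝒜] {X : Type*}
    (p : 𝒮 × 𝒢 × 𝒜 → ℝ) (f : 𝒮 × 𝒢 × 𝒜 → X) (x : X) : ℝ :=
  ∑ ω : 𝒮 × 𝒢 × 𝒜, if f ω = x then p ω else 0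

/-- Conditional mutual information `I(X;Y|W)` of discrete random variables that are
deterministic functions of a sample drawn from the pmf `p` on `𝒮 × 𝒢 × 𝒜`. -/
noncomputable def CMI {𝒮 𝒢 𝒜 : Type*} [Fintype 𝒮] [Fintype 𝒢] [Fintype 𝒜]
    {X Y W : Type*} [Fintype X] [Fintype Y] [Fintype W]
    (p : 𝒮 × 𝒢 × 𝒜 → ℝ) (fX : 𝒮 × 𝒢 × 𝒜 → X) (fY : 𝒮 × 𝒢 × 𝒜 → Y)
    (fW : 𝒮 × 𝒢 × 𝒜 → W) : ℝ :=
  ∑ x : X, ∑ y : Y, ∑ w : W,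
    if 0 < Pr p (fun ω => (fX ω, fY ω, fW ω)) (x, y, w) then
      Pr p (fun ω => (fX ω, fY ω, fW ω)) (x, y, w) *
        Real.log ((Pr p (fun ω => (fX ω, fY ω, fW ω)) (x, y, w) * Pr p fW w) /
          (Pr p (fun ω => (fX ω, fW ω)) (x, w) * Pr p (fun ω => (fY ω, fW ω)) (y, w)))
    else 0

/-- Marginal `p(s,g) := ∑ₐ p(s,g,a)`. -/
noncomputable def pSG {𝒮 𝒢 𝒜 : Type*} [Fintype 𝒜] (p : 𝒮 × 𝒢 × 𝒜 → ℝ) (s : 𝒮) (g : 𝒢) : ℝ :=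
  ∑ a : 𝒜, p (s, g, a)

/-- Conditional `p(a|s,g) := p(s,g,a) / p(s,g)`. -/
noncomputable def pA {𝒮 𝒢 𝒜 : Type*} [Fintype 𝒜] (p : 𝒮 × 𝒢 × 𝒜 → ℝ) (s : 𝒮) (g : 𝒢)
    (a : 𝒜) : ℝ :=
  p (s, g, a) / pSG p s g

/-- Marginal `P(S = s, φ(S,G) = z) = ∑_{g' : φ(s,g')=z} p(s,g')`. -/
noncomputable def pSZ {𝒮 𝒢 𝒜 𝒵 : Type*} [Fintype 𝒢] [Fintype 𝒜] (p : 𝒮 × 𝒢 × 𝒜 → ℝ)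
    (φ : 𝒮 × 𝒢 → 𝒵) (s : 𝒮) (z : 𝒵) : ℝ :=
  ∑ g' : 𝒢, if φ (s, g') = z then pSG p s g' else 0

/-- Induced representation-conditioned distribution
`p(a|s,z) := (∑_{g' : φ(s,g')=z} p(s,g',a)) / (∑_{g' : φ(s,g')=z} p(s,g'))`. -/
noncomputable def pAZ {𝒮 𝒢 𝒜 𝒵 : Type*} [Fintype 𝒢] [Fintype 𝒜] (p : 𝒮 × 𝒢 × 𝒜 → ℝ)
    (φ : 𝒮 × 𝒢 → 𝒵) (s : 𝒮) (z : 𝒵) (a : 𝒜) : ℝ :=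
  (∑ g' : 𝒢, if φ (s, g') = z then p (s, g', a) else 0) /
    (∑ g' : 𝒢, if φ (s, g') = z then pSG p s g' else 0)

/-- The conditional KL risk `R(π;φ)`. -/
noncomputable def KLRisk {𝒮 𝒢 𝒜 𝒵 : Type*} [Fintype 𝒮] [Fintype 𝒢] [Fintype 𝒜]
    (p : 𝒮 × 𝒢 × 𝒜 → ℝ) (φ : 𝒮 × 𝒢 → 𝒵) (π : 𝒮 → 𝒵 → 𝒜 → ℝ) : ℝ :=
  ∑ s : 𝒮, ∑ g : 𝒢,
    if 0 < pSG p s g then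
      pSG p s g * ∑ a : 𝒜,
        (if 0 < pA p s g a then pA p s g a * Real.log (pA p s g a / π s (φ (s, g)) a) else 0)
    else 0

/-- The modeling error `M(π;φ)`. -/
noncomputable def ModelErr {𝒮 𝒢 𝒜 𝒵 : Type*} [Fintype 𝒮] [Fintype 𝒢] [Fintype 𝒜] [Fintype 𝒵]
    (p : 𝒮 × 𝒢 × 𝒜 → ℝ) (φ : 𝒮 × 𝒢 → 𝒵) (π : 𝒮 → 𝒵 → 𝒜 → ℝ) : ℝ :=
  ∑ s : 𝒮, ∑ z : 𝒵,
    if 0 < pSZ p φ s z then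
      pSZ p φ s z * ∑ a : 𝒜,
        (if 0 < pAZ p φ s z a then pAZ p φ s z a * Real.log (pAZ p φ s z a / π s z a) else 0)
    else 0

section helpers

variable {𝒮 𝒢 𝒜 𝒵 : Type*} [Fintype 𝒮] [Fintype 𝒢] [Fintype 𝒜] [Fintype 𝒵]

/-- `P(S = s, Z = z, A = a)`. -/
noncomputable def pSZA (p : 𝒮 × 𝒢 × 𝒜 → ℝ) (φ : 𝒮 × 𝒢 → 𝒵) (s : 𝒮) (z : 𝒵) (a : 𝒜) : ℝ :=
  ∑ g : 𝒢, if φ (s, g) = z then p (s, g, a) else 0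

lemma Pr_agsz (p : 𝒮 × 𝒢 × 𝒜 → ℝ) (φ : 𝒮 × 𝒢 → 𝒵) (s : 𝒮) (g : 𝒢) (a : 𝒜) (z : 𝒵) :
    Pr p (fun ω => (ω.2.2, ω.2.1, (ω.1, φ (ω.1, ω.2.1)))) (a, g, (s, z)) =
      if φ (s, g) = z then p (s, g, a) else 0 := by
  unfold Pr
  rw [Fintype.sum_eq_single (s, g, a)]
  · simp
  · rintro ⟨s', g', a'⟩ h
    rw [if_neg]
    simp only [Prod.mk.injEq]
    rintro ⟨rfl, rfl, rfl, _⟩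
    exact h rfl

lemma Pr_sz (p : 𝒮 × 𝒢 × 𝒜 → ℝ) (φ : 𝒮 × 𝒢 → 𝒵) (s : 𝒮) (z : 𝒵) :
    Pr p (fun ω => (ω.1, φ (ω.1, ω.2.1))) (s, z) = pSZ p φ s z := by
  unfold Pr pSZ pSG
  rw [Fintype.sum_prod_type, Fintype.sum_eq_single s]
  · rw [Fintype.sum_prod_type]
    refine Finset.sum_congr rfl fun g _ => ?_
    by_cases h : φ (s, g) = z <;> simp [h]
  · intro s' h
    simp [h]

lemma Pr_asz (p : 𝒮 × 𝒢 × 𝒜 → ℝ) (φ : 𝒮 × 𝒢 → 𝒵) (s : 𝒮) (z : 𝒵) (a : 𝒜) :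
    Pr p (fun ω => (ω.2.2, (ω.1, φ (ω.1, ω.2.1)))) (a, (s, z)) = pSZA p φ s z a := by
  unfold Pr pSZA
  rw [Fintype.sum_prod_type, Fintype.sum_eq_single s]
  · rw [Fintype.sum_prod_type]
    refine Finset.sum_congr rfl fun g _ => ?_
    by_cases h : φ (s, g) = z <;> simp [h]
  · intro s' h
    simp [h]

lemma Pr_gsz (p : 𝒮 × 𝒢 × 𝒜 → ℝ) (φ : 𝒮 × 𝒢 → 𝒵) (s : 𝒮) (g : 𝒢) :
    Pr p (fun ω => (ω.2.1, (ω.1, φ (ω.1, ω.2.1)))) (g, (s, φ (s, g))) = pSG p s g := by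
  unfold Pr pSG
  rw [Fintype.sum_prod_type, Fintype.sum_eq_single s]
  · rw [Fintype.sum_prod_type, Fintype.sum_eq_single g]
    · simp
    · intro g' h
      simp [h]
  · intro s' h
    simp [h]

lemma CMI_eq (p : 𝒮 × 𝒢 × 𝒜 → ℝ) (φ : 𝒮 × 𝒢 → 𝒵) :
    CMI p (fun ω => ω.2.2) (fun ω => ω.2.1) (fun ω => (ω.1, φ (ω.1, ω.2.1))) =
      ∑ s, ∑ g, ∑ a, if 0 < p (s, g, a) then p (s, g, a) *
        Real.log ((p (s, g, a) * pSZ p φ s (φ (s, g))) /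
          (pSZA p φ s (φ (s, g)) a * pSG p s g)) else 0 := by
  unfold CMI
  have key : ∀ a g, (∑ w : 𝒮 × 𝒵,
    if 0 < Pr p (fun ω => (ω.2.2, ω.2.1, (ω.1, φ (ω.1, ω.2.1)))) (a, g, w) then
      Pr p (fun ω => (ω.2.2, ω.2.1, (ω.1, φ (ω.1, ω.2.1)))) (a, g, w) *
        Real.log ((Pr p (fun ω => (ω.2.2, ω.2.1, (ω.1, φ (ω.1, ω.2.1)))) (a, g, w) *
          Pr p (fun ω => (ω.1, φ (ω.1, ω.2.1))) w) /
          (Pr p (fun ω => (ω.2.2, (ω.1, φ (ω.1, ω.2.1)))) (a, w) *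
            Pr p (fun ω => (ω.2.1, (ω.1, φ (ω.1, ω.2.1)))) (g, w)))
    else 0) = ∑ s, if 0 < p (s, g, a) then p (s, g, a) *
        Real.log ((p (s, g, a) * pSZ p φ s (φ (s, g))) /
          (pSZA p φ s (φ (s, g)) a * pSG p s g)) else 0 := by
    intro a g
    rw [Fintype.sum_prod_type]
    refine Finset.sum_congr rfl fun s _ => ?_
    rw [Fintype.sum_eq_single (φ (s, g))]
    · rw [Pr_agsz, Pr_sz, Pr_asz, Pr_gsz, if_pos rfl]
    · intro z h
      rw [Pr_agsz, if_neg h.symm, if_neg (lt_irrefl _)]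
  simp only [key]
  rw [Finset.sum_comm]
  trans
  · exact Finset.sum_congr rfl fun g _ => Finset.sum_comm
  · exact Finset.sum_comm

lemma pSG_pos (p : 𝒮 × 𝒢 × 𝒜 → ℝ) (hp0 : ∀ ω, 0 ≤ p ω) {s : 𝒮} {g : 𝒢} {a : 𝒜}
    (h : 0 < p (s, g, a)) : 0 < pSG p s g :=
  Finset.sum_pos' (fun _ _ => hp0 _) ⟨a, Finset.mem_univ _, h⟩

lemma KLRisk_eq (p : 𝒮 × 𝒢 × 𝒜 → ℝ) (hp0 : ∀ ω, 0 ≤ p ω) (φ : 𝒮 × 𝒢 → 𝒵)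
    (π : 𝒮 → 𝒵 → 𝒜 → ℝ) :
    KLRisk p φ π = ∑ s, ∑ g, ∑ a, if 0 < p (s, g, a) then p (s, g, a) *
        Real.log (p (s, g, a) / pSG p s g / π s (φ (s, g)) a) else 0 := by
  unfold KLRisk
  refine Finset.sum_congr rfl fun s _ => Finset.sum_congr rfl fun g _ => ?_
  by_cases h : 0 < pSG p s g
  · rw [if_pos h, Finset.mul_sum]
    refine Finset.sum_congr rfl fun a _ => ?_
    unfold pA
    by_cases h' : 0 < p (s, g, a)
    · rw [if_pos h', if_pos (div_pos h' h), ← mul_assoc, mul_div_cancel₀ _ h.ne']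
    · have h0 : p (s, g, a) = 0 := le_antisymm (not_lt.1 h') (hp0 _)
      simp [h0]
  · rw [if_neg h]
    symm
    refine Finset.sum_eq_zero fun a _ => if_neg fun h' => h (pSG_pos p hp0 h')

lemma gibbs_sum (p : 𝒮 × 𝒢 × 𝒜 → ℝ) (hp0 : ∀ ω, 0 ≤ p ω) (φ : 𝒮 × 𝒢 → 𝒵)
    (π : 𝒮 → 𝒵 → 𝒜 → ℝ)
    (hπpos : ∀ s z a, 0 < π s z a) (hπsum : ∀ s z, ∑ a : 𝒜, π s z a = 1) (s : 𝒮) :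
    ∑ g, ∑ a, p (s, g, a) * (pSZ p φ s (φ (s, g)) * π s (φ (s, g)) a / pSZA p φ s (φ (s, g)) a)
      ≤ ∑ g, ∑ a, p (s, g, a) := by
  have hr : ∀ z, 0 ≤ pSZ p φ s z := fun z => Finset.sum_nonneg fun g _ => by
    split_ifs
    · exact Finset.sum_nonneg fun a _ => hp0 _
    · exact le_rfl
  calc ∑ g, ∑ a, p (s, g, a) *
        (pSZ p φ s (φ (s, g)) * π s (φ (s, g)) a / pSZA p φ s (φ (s, g)) a)
      = ∑ g, ∑ z, ∑ a, (if φ (s, g) = z then p (s, g, a) else 0) *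
        (pSZ p φ s z * π s z a / pSZA p φ s z a) := by
        refine Finset.sum_congr rfl fun g _ => ?_
        rw [Fintype.sum_eq_single (φ (s, g))]
        · simp
        · intro z h
          simp [h.symm]
    _ = ∑ z, ∑ a, pSZA p φ s z a * (pSZ p φ s z * π s z a / pSZA p φ s z a) := by
        rw [Finset.sum_comm]
        refine Finset.sum_congr rfl fun z _ => ?_
        rw [Finset.sum_comm]
        refine Finset.sum_congr rfl fun a _ => ?_
        rw [← Finset.sum_mul]
        rfl
    _ ≤ ∑ z, ∑ a, pSZ p φ s z * π s z a := by
        refine Finset.sum_le_sum fun z _ => Finset.sum_le_sum fun a _ => ?_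
        by_cases h : pSZA p φ s z a = 0
        · rw [h, zero_mul]
          exact mul_nonneg (hr z) (hπpos s z a).le
        · rw [mul_div_cancel₀ _ h]
    _ = ∑ z, pSZ p φ s z := by
        simp only [← Finset.mul_sum, hπsum, mul_one]
    _ = ∑ g, ∑ a, p (s, g, a) := by
        unfold pSZ pSG
        rw [Finset.sum_comm]
        simp

end helpers

/-- For every policy `π` and representation `φ` with `Z = φ(S,G)`,
the conditional KL risk is bounded below by the representation error:
`R(π;φ) ≥ I(A;G|S,Z)`. -/
theorem klRisk_ge_cmi {𝒮 𝒢 𝒜 𝒵 : Type*}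
    [Fintype 𝒮] [Fintype 𝒢] [Fintype 𝒜] [Fintype 𝒵]
    [Nonempty 𝒮] [Nonempty 𝒢] [Nonempty 𝒜] [Nonempty 𝒵]
    (p : 𝒮 × 𝒢 × 𝒜 → ℝ) (hp0 : ∀ ω, 0 ≤ p ω) (hp1 : ∑ ω : 𝒮 × 𝒢 × 𝒜, p ω = 1)
    (φ : 𝒮 × 𝒢 → 𝒵) (π : 𝒮 → 𝒵 → 𝒜 → ℝ)
    (hπpos : ∀ s z a, 0 < π s z a) (hπsum : ∀ s z, ∑ a : 𝒜, π s z a = 1) :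
    KLRisk p φ π ≥
      CMI p (fun ω => ω.2.2) (fun ω => ω.2.1) (fun ω => (ω.1, φ (ω.1, ω.2.1))) := by
  rw [ge_iff_le, KLRisk_eq p hp0, CMI_eq]
  refine Finset.sum_le_sum fun s _ => ?_
  have hg := gibbs_sum p hp0 φ π hπpos hπsum s
  rw [← sub_nonneg, ← Finset.sum_sub_distrib] at hg ⊢
  refine hg.trans (Finset.sum_le_sum fun g _ => ?_)
  rw [← Finset.sum_sub_distrib, ← Finset.sum_sub_distrib]
  refine Finset.sum_le_sum fun a _ => ?_
  by_cases h : 0 < p (s, g, a)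
  · rw [if_pos h, if_pos h]
    have hq := pSG_pos p hp0 h
    have hw := hπpos s (φ (s, g)) a
    have ht : 0 < pSZA p φ s (φ (s, g)) a :=
      Finset.sum_pos' (fun g' _ => by split_ifs <;> simp [hp0])
        ⟨g, Finset.mem_univ _, by simpa using h⟩
    have hr : 0 < pSZ p φ s (φ (s, g)) :=
      Finset.sum_pos' (fun g' _ => by
        split_ifs
        · exact Finset.sum_nonneg fun a _ => hp0 _
        · exact le_rfl)
        ⟨g, Finset.mem_univ _, by simpa using hq⟩
    have hl := Real.log_le_sub_one_of_pos (div_pos (mul_pos hr hw) ht)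
    rw [Real.log_div (mul_pos hr hw).ne' ht.ne', Real.log_mul hr.ne' hw.ne'] at hl
    rw [Real.log_div (div_pos h hq).ne' hw.ne', Real.log_div h.ne' hq.ne',
      Real.log_div (mul_pos h hr).ne' (mul_pos ht hq).ne', Real.log_mul h.ne' hr.ne',
      Real.log_mul ht.ne' hq.ne']
    have := mul_le_mul_of_nonneg_left hl h.le
    linarith
  · have h0 : p (s, g, a) = 0 := le_antisymm (not_lt.1 h) (hp0 _)
    simp [h0]
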